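/- For every integer k ≥ 1, p_{k+2} = (2(k²+1)/(k(k+1)))·p_k. -/

import Mathlib

open MeasureTheory

/-- The cubic NLS soliton profile. -/
noncomputable def Q (y : ℝ) : ℝ := Real.sqrt 2 / Real.cosh y

/-- `p k = ∫ Q^k cos`. -/
noncomputable def p (k : ℕ) : ℝ := ∫ y : ℝ, (Q y) ^ k * Real.cos y

lemma one_add_sq_div_four_le_cosh (y : ℝ) : (1 + y ^ 2) / 4 ≤ Real.cosh y := by
  rw [← Real.cosh_abs, ← sq_abs y, Real.cosh_eq]
  have h := Real.quadratic_le_exp_of_nonneg (abs_nonneg y)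
  linarith [abs_nonneg y, Real.exp_pos (-|y|)]

lemma Q_nonneg (y : ℝ) : 0 ≤ Q y :=
  div_nonneg (Real.sqrt_nonneg 2) (Real.cosh_pos y).le

lemma Q_le_sqrt_two (y : ℝ) : Q y ≤ √2 :=
  div_le_self (Real.sqrt_nonneg 2) (Real.one_le_cosh y)

lemma continuous_Q : Continuous Q :=
  continuous_const.div Real.continuous_cosh fun y ↦ (Real.cosh_pos y).ne'

lemma integrable_Q : Integrable Q := by
  refine (integrable_inv_one_add_sq.const_mul (4 * √2)).mono'
    continuous_Q.aestronglyMeasurable (ae_of_all _ fun y ↦ ?_)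
  rw [Real.norm_of_nonneg (Q_nonneg y)]
  calc Q y ≤ √2 / ((1 + y ^ 2) / 4) :=
        div_le_div_of_nonneg_left (Real.sqrt_nonneg 2) (by positivity)
          (one_add_sq_div_four_le_cosh y)
    _ = 4 * √2 * (1 + y ^ 2)⁻¹ := by field_simp

lemma integrable_Q_pow_mul {k : ℕ} (hk : 1 ≤ k) {g : ℝ → ℝ} (hg : Continuous g) {C : ℝ}
    (hC : ∀ y, |g y| ≤ C) : Integrable fun y ↦ Q y ^ k * g y := by
  obtain ⟨n, rfl⟩ := Nat.exists_eq_add_of_le' hk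
  refine (integrable_Q.const_mul (√2 ^ n * C)).mono'
    ((continuous_Q.pow _).mul hg).aestronglyMeasurable (ae_of_all _ fun y ↦ ?_)
  have hQ := Q_nonneg y
  have hC₀ : 0 ≤ C := (abs_nonneg _).trans (hC y)
  rw [Real.norm_eq_abs, abs_mul, abs_of_nonneg (pow_nonneg hQ _), pow_succ]
  calc Q y ^ n * Q y * |g y| ≤ √2 ^ n * Q y * C := by
        gcongr
        · exact Q_le_sqrt_two y
        · exact hC y
    _ = √2 ^ n * C * Q y := by ring

lemma tanh_sq_eq_one_sub_Q_sq (y : ℝ) : Real.tanh y ^ 2 = 1 - Q y ^ 2 / 2 := by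
  have hc := (Real.cosh_pos y).ne'
  rw [Real.tanh_eq_sinh_div_cosh, Q, div_pow, div_pow, Real.sq_sqrt zero_le_two, Real.sinh_sq]
  field_simp

lemma hasDerivAt_Q (y : ℝ) : HasDerivAt Q (-(Q y * Real.tanh y)) y := by
  have hc := (Real.cosh_pos y).ne'
  refine ((hasDerivAt_const y (√2)).div (Real.hasDerivAt_cosh y) hc).congr_deriv ?_
  rw [Real.tanh_eq_sinh_div_cosh, Q]
  field_simp
  ring

lemma hasDerivAt_tanh_Q (y : ℝ) : HasDerivAt Real.tanh (Q y ^ 2 / 2) y := by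
  have hc := (Real.cosh_pos y).ne'
  have h := (Real.hasDerivAt_sinh y).div (Real.hasDerivAt_cosh y) hc
  rw [show Real.tanh = Real.sinh / Real.cosh from funext Real.tanh_eq_sinh_div_cosh]
  refine h.congr_deriv ?_
  rw [Q, div_pow, Real.sq_sqrt zero_le_two, ← sq, ← sq, Real.cosh_sq_sub_sinh_sq]
  field_simp

lemma hasDerivAt_Q_pow {k : ℕ} (hk : 1 ≤ k) (y : ℝ) :
    HasDerivAt (fun y ↦ Q y ^ k) (-(k * Q y ^ k * Real.tanh y)) y := by
  refine ((hasDerivAt_Q y).pow k).congr_deriv ?_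
  rw [← pow_sub_one_mul (Nat.one_le_iff_ne_zero.mp hk) (Q y)]
  ring

/-- The derivative of `Q ^ k * sin + deriv (Q ^ k) * cos`, rewritten with the soliton equation. -/
lemma hasDerivAt_Q_pow_mul_sin_sub {k : ℕ} (hk : 1 ≤ k) (y : ℝ) :
    HasDerivAt (fun y ↦ Q y ^ k * (Real.sin y - k * (Real.tanh y * Real.cos y)))
      (((k : ℝ) ^ 2 + 1) * (Q y ^ k * Real.cos y) -
        (k : ℝ) * (k + 1) / 2 * (Q y ^ (k + 2) * Real.cos y)) y := by
  refine ((hasDerivAt_Q_pow hk y).mul ((Real.hasDerivAt_sin y).sub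
    (((hasDerivAt_tanh_Q y).mul (Real.hasDerivAt_cos y)).const_mul (k : ℝ)))).congr_deriv ?_
  simp only [Pi.sub_apply, Pi.mul_apply]
  linear_combination ((k : ℝ) ^ 2 * Q y ^ k * Real.cos y) * tanh_sq_eq_one_sub_Q_sq y

theorem stmt11 :
    ∀ k : ℕ, 1 ≤ k →
      p (k + 2) = (2 * ((k : ℝ) ^ 2 + 1) / ((k : ℝ) * ((k : ℝ) + 1))) * p k := by
  intro k hk
  have hk₀ : (0 : ℝ) < k := by exact_mod_cast hk
  have hcos {m : ℕ} (hm : 1 ≤ m) : Integrable fun y ↦ Q y ^ m * Real.cos y :=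
    integrable_Q_pow_mul hm Real.continuous_cos Real.abs_cos_le_one
  have h₁ := (hcos hk).const_mul ((k : ℝ) ^ 2 + 1)
  have h₂ := (hcos (Nat.le_add_right_of_le hk : 1 ≤ k + 2)).const_mul ((k : ℝ) * (k + 1) / 2)
  have htanh : Continuous Real.tanh :=
    continuous_iff_continuousAt.mpr fun y ↦ (hasDerivAt_tanh_Q y).continuousAt
  have hF : Integrable fun y ↦ Q y ^ k * (Real.sin y - k * (Real.tanh y * Real.cos y)) := by
    refine integrable_Q_pow_mul hk (C := 1 + k * (1 * 1)) (by fun_prop) fun y ↦ ?_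
    refine (abs_sub _ _).trans ?_
    rw [abs_mul, abs_mul, Nat.abs_cast]
    gcongr
    · exact Real.abs_sin_le_one y
    · exact abs_le.mpr ⟨(Real.neg_one_lt_tanh y).le, (Real.tanh_lt_one y).le⟩
    · exact Real.abs_cos_le_one y
  have h := integral_eq_zero_of_hasDerivAt_of_integrable
    (hasDerivAt_Q_pow_mul_sin_sub hk) (h₁.sub h₂) hF
  rw [integral_sub h₁ h₂, integral_const_mul, integral_const_mul] at h
  change ((k : ℝ) ^ 2 + 1) * p k - (k : ℝ) * (k + 1) / 2 * p (k + 2) = 0 at h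
  field_simp
  linear_combination -2 * h
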